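/- arXiv:1402.1787 — 4 statements merged into one kernel-verified Lean document; each statement's English description precedes it below -/
import Mathlib

section
/- Under these hypotheses, q(u,v) ≥ (α²/4)‖u‖² for all (u,v) ∈ H × H, and for every 1-Lipschitz map S : H → H (i.e. ‖S u₁ − S u₂‖ ≤ ‖u₁ − u₂‖ for all u₁,u₂), the map G : H × H → H × H defined by G(u,v) = (0, S u) satisfies √(q(G Y₁ − G Y₂)) ≤ (2/α) √(q(Y₁ − Y₂)) for all Y₁, Y₂ ∈ H × H. -/
/-- `q(u,v) ≥ (α²/4)‖u‖²` for all `(u,v)`, and for every 1-Lipschitz map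
`S : H → H`, the map `G(u,v) = (0, S u)` satisfies
`√(q(G Y₁ − G Y₂)) ≤ (2/α) √(q(Y₁ − Y₂))` for all `Y₁, Y₂ ∈ H × H`
(the Lipschitz bound `L_F ≤ 2/α` of the paper). -/
theorem stmt2
    {H F : Type*} [NormedAddCommGroup H] [InnerProductSpace ℝ H]
    [NormedAddCommGroup F] [InnerProductSpace ℝ F]
    (α lam₁ δ : ℝ) (hα : 0 < α) (hlam₁ : 0 < lam₁) (hδ : δ ∈ Set.Ioc (0 : ℝ) 1)
    (B : H →ₗ[ℝ] F) (hB : ∀ u : H, lam₁ * ‖u‖ ^ 2 ≤ ‖B u‖ ^ 2)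
    (q : H × H → ℝ)
    (hq : ∀ u v : H,
      q (u, v) = ‖B u‖ ^ 2 + (α ^ 2 / 4 - δ * lam₁) * ‖u‖ ^ 2 + ‖(α / 2) • u + v‖ ^ 2) :
    (∀ u v : H, α ^ 2 / 4 * ‖u‖ ^ 2 ≤ q (u, v)) ∧
    (∀ S : H → H, (∀ u₁ u₂ : H, ‖S u₁ - S u₂‖ ≤ ‖u₁ - u₂‖) →
      ∀ Y₁ Y₂ : H × H,
        Real.sqrt (q (((0 : H), S Y₁.1) - ((0 : H), S Y₂.1))) ≤
          (2 / α) * Real.sqrt (q (Y₁ - Y₂))) := by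
  have lower : ∀ u v : H, α ^ 2 / 4 * ‖u‖ ^ 2 ≤ q (u, v) := by
    intro u v
    have hδu : δ * (lam₁ * ‖u‖ ^ 2) ≤ lam₁ * ‖u‖ ^ 2 :=
      mul_le_of_le_one_left (by positivity) hδ.2
    rw [hq]
    linarith [hB u, sq_nonneg ‖(α / 2) • u + v‖]
  refine ⟨lower, ?_⟩
  rintro S hS ⟨u₁, v₁⟩ ⟨u₂, v₂⟩
  have sqrt_eq : Real.sqrt (q (((0 : H), S u₁) - ((0 : H), S u₂))) = ‖S u₁ - S u₂‖ := by
    simp [hq]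
  have le_sqrt : α / 2 * ‖u₁ - u₂‖ ≤ Real.sqrt (q ((u₁, v₁) - (u₂, v₂))) := by
    refine Real.le_sqrt_of_sq_le ?_
    rw [Prod.mk_sub_mk]
    linarith [lower (u₁ - u₂) (v₁ - v₂)]
  calc Real.sqrt (q (((0 : H), S u₁) - ((0 : H), S u₂)))
      = ‖S u₁ - S u₂‖ := sqrt_eq
    _ ≤ ‖u₁ - u₂‖ := hS u₁ u₂
    _ = 2 / α * (α / 2 * ‖u₁ - u₂‖) := by field_simp
    _ ≤ 2 / α * Real.sqrt (q ((u₁, v₁) - (u₂, v₂))) := by gcongr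
end

section
/- For all real numbers u and v, −δλ₁ u v − (λα/2) u² − (α/2) v² ≤ −a · ((λ + α²/2 − δλ₁) u² + α u v + v²). (The left-hand side equals the value ⟨C_λ(u,v),(u,v)⟩ of the bilinear form associated with q_λ at the image of (u,v) under C_λ, so this is the per-eigenmode form of the dissipativity estimate ⟨CY,Y⟩_E ≤ −a‖Y‖²_E of Lemma 3.3(1).) -/
/-- Per-eigenmode dissipativity estimate (Lemma 3.3(1)): for all `u, v ∈ ℝ`,
`−δλ₁ u v − (λα/2) u² − (α/2) v² ≤ −a ((λ + α²/2 − δλ₁) u² + α u v + v²)`,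
where `a = α/2 − |α/2 − δλ₁/α|`. -/
theorem stmt3
    (α lam₁ δ lam : ℝ) (hα : 0 < α) (hlam₁ : 0 < lam₁) (hδ : δ ∈ Set.Ioc (0 : ℝ) 1)
    (hδlam₁ : δ * lam₁ < α ^ 2)
    (a : ℝ) (ha : a = α / 2 - |α / 2 - δ * lam₁ / α|)
    (hlam : lam₁ ≤ lam) :
    ∀ u v : ℝ,
      -(δ * lam₁) * u * v - lam * α / 2 * u ^ 2 - α / 2 * v ^ 2 ≤
        -a * ((lam + α ^ 2 / 2 - δ * lam₁) * u ^ 2 + α * u * v + v ^ 2) := by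
  intro u v
  obtain ⟨s, hs⟩ : ∃ s, s = δ * lam₁ / α := ⟨_, rfl⟩
  have hc : δ * lam₁ = α * s := by rw [hs]; field_simp
  have hlam_ge : 0 ≤ lam - α * s := by
    have := mul_le_of_le_one_left hlam₁.le hδ.2
    linarith
  rw [← hs] at ha
  rw [hc]
  rcases le_total s (α / 2) with h | h
  · rw [abs_of_nonneg (sub_nonneg.2 h)] at ha
    obtain rfl : a = s := by linarith
    have hdiff : 0 ≤ (α / 2 - a) * ((lam - α * a) * u ^ 2 + v ^ 2) :=
      mul_nonneg (sub_nonneg.2 h) (by positivity)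
    linear_combination hdiff
  · rw [abs_of_nonpos (sub_nonpos.2 h)] at ha
    obtain rfl : a = α - s := by linarith
    have hdiff : 0 ≤ (s - α / 2) * ((lam - α * s) * u ^ 2 + (α * u + v) ^ 2) :=
      mul_nonneg (sub_nonneg.2 h) (by positivity)
    linear_combination hdiff
end

section
/- Let u : ℝ → ℝ be twice differentiable and satisfy the damped oscillator equation u''(t) + α u'(t) + λ u(t) = 0 for all t (equivalently, Y = (u, u') solves Y' = C_λ Y). Then for all t ≥ 0, q_λ(u(t), u'(t)) ≤ e^{−2at} · q_λ(u(0), u'(0)). (This is the per-eigenmode form of the semigroup decay estimate ‖e^{Ct}Q‖ ≤ e^{−at} of Lemma 3.3(2).) -/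
/-- Exponential decay from a linear differential inequality. -/
theorem le_exp_mul_of_hasDerivAt_le {f f' : ℝ → ℝ} {c : ℝ}
    (hf : ∀ t, HasDerivAt f (f' t) t) (hle : ∀ t, f' t ≤ c * f t) {t : ℝ} (ht : 0 ≤ t) :
    f t ≤ Real.exp (c * t) * f 0 := by
  have hg : ∀ s, HasDerivAt (fun s => Real.exp (-(c * s)) * f s)
      (Real.exp (-(c * s)) * (f' s - c * f s)) s := fun s => by
    refine ((((hasDerivAt_id' s).const_mul c).fun_neg.exp).fun_mul (hf s)).congr_deriv ?_
    ring
  have hanti := antitone_of_hasDerivAt_nonpos hg fun s =>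
    mul_nonpos_of_nonneg_of_nonpos (Real.exp_nonneg _) (sub_nonpos.2 (hle s))
  have h := hanti ht
  simp only [mul_zero, neg_zero, Real.exp_zero, one_mul] at h
  calc f t = Real.exp (c * t) * (Real.exp (-(c * t)) * f t) := by
        rw [← mul_assoc, ← Real.exp_add]; simp
    _ ≤ Real.exp (c * t) * f 0 := by gcongr

/-- Dissipativity of the damped oscillator matrix in the equivalent norm, with `w = v + α u / 2`. -/
theorem mul_cross_term_le {α d lam : ℝ} (hd : d ≤ lam) (s u v : ℝ) :
    α * s * (u * (v + α / 2 * u)) ≤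
      |s| * ((lam + α ^ 2 / 2 - d) * u ^ 2 + α * u * v + v ^ 2) := by
  have hu : 0 ≤ (lam - d) * u ^ 2 := mul_nonneg (sub_nonneg.2 hd) (sq_nonneg u)
  have h : |α * (u * (v + α / 2 * u))| ≤
      (lam + α ^ 2 / 2 - d) * u ^ 2 + α * u * v + v ^ 2 :=
    abs_le.2 ⟨by nlinarith [sq_nonneg (v + α * u)], by nlinarith [sq_nonneg v]⟩
  calc α * s * (u * (v + α / 2 * u)) ≤ |s * (α * (u * (v + α / 2 * u)))| :=
        (le_abs_self _).trans_eq' (by ring)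
    _ ≤ _ := by rw [abs_mul]; gcongr

/-- Per-eigenmode semigroup decay (Lemma 3.3(2)): if `u : ℝ → ℝ` is twice
differentiable and satisfies `u'' + α u' + λ u = 0`, then for all `t ≥ 0`,
`q_λ(u(t), u'(t)) ≤ e^{−2at} q_λ(u(0), u'(0))`, where
`q_λ(u,v) = (λ + α²/2 − δλ₁) u² + α u v + v²` and `a = α/2 − |α/2 − δλ₁/α|`. -/
theorem stmt4
    (α lam₁ δ lam : ℝ) (hα : 0 < α) (hlam₁ : 0 < lam₁) (hδ : δ ∈ Set.Ioc (0 : ℝ) 1)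
    (hδlam₁ : δ * lam₁ < α ^ 2)
    (a : ℝ) (ha : a = α / 2 - |α / 2 - δ * lam₁ / α|)
    (hlam : lam₁ ≤ lam)
    (q : ℝ → ℝ → ℝ)
    (hq : ∀ u v : ℝ, q u v = (lam + α ^ 2 / 2 - δ * lam₁) * u ^ 2 + α * u * v + v ^ 2)
    (u : ℝ → ℝ)
    (hu : Differentiable ℝ u) (hu' : Differentiable ℝ (deriv u))
    (hode : ∀ t : ℝ, deriv (deriv u) t + α * deriv u t + lam * u t = 0) :
    ∀ t : ℝ, 0 ≤ t →
      q (u t) (deriv u t) ≤ Real.exp (-2 * a * t) * q (u 0) (deriv u 0) := by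
  have hd : δ * lam₁ ≤ lam := (mul_le_of_le_one_left hlam₁.le hδ.2).trans hlam
  have hderiv : ∀ t, HasDerivAt (fun t => q (u t) (deriv u t))
      (-α * q (u t) (deriv u t) +
        2 * (α * (α / 2 - δ * lam₁ / α) * (u t * (deriv u t + α / 2 * u t)))) t := fun t => by
    have h₀ := (hu t).hasDerivAt
    have h₁ := (hu' t).hasDerivAt
    rw [show deriv (deriv u) t = -α * deriv u t - lam * u t by linarith [hode t]] at h₁
    simp only [hq]
    refine ((((h₀.fun_pow 2).const_mul (lam + α ^ 2 / 2 - δ * lam₁)).fun_add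
      ((h₀.const_mul α).fun_mul h₁)).fun_add (h₁.fun_pow 2)).congr_deriv ?_
    field_simp
    norm_num
    ring
  intro t ht
  refine le_exp_mul_of_hasDerivAt_le hderiv (fun t => ?_) ht
  have h := mul_cross_term_le (α := α) hd (α / 2 - δ * lam₁ / α) (u t) (deriv u t)
  rw [← hq] at h
  rw [ha]
  linarith
end

section
/- Let a and L be real numbers with 0 ≤ L and a > 4L. Let P, Q : [0,∞) → ℝ be differentiable functions with P(t) > 0 and Q(t) ≥ 0 for all t ≥ 0, with Q(0) ≤ P(0), and suppose that for all t ≥ 0: P'(t) ≥ −2L(P(t) + √(P(t)Q(t))) and Q'(t) ≤ −2a Q(t) + 2L(√(P(t)Q(t)) + Q(t)). Then Q(t) ≤ P(t) for all t ≥ 0. -/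
/-- Differential-inequality core of Lemma 5.1: if `0 ≤ L`, `a > 4L`,
`P, Q : [0,∞) → ℝ` are differentiable with `P > 0`, `Q ≥ 0`, `Q(0) ≤ P(0)`,
`P' ≥ −2L(P + √(PQ))` and `Q' ≤ −2aQ + 2L(√(PQ) + Q)`, then `Q(t) ≤ P(t)` for all `t ≥ 0`. -/
theorem stmt6
    (a L : ℝ) (hL : 0 ≤ L) (ha : 4 * L < a)
    (P Q : ℝ → ℝ)
    (hPdiff : ∀ t : ℝ, 0 ≤ t → DifferentiableAt ℝ P t)
    (hQdiff : ∀ t : ℝ, 0 ≤ t → DifferentiableAt ℝ Q t)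
    (hPpos : ∀ t : ℝ, 0 ≤ t → 0 < P t)
    (hQnonneg : ∀ t : ℝ, 0 ≤ t → 0 ≤ Q t)
    (h0 : Q 0 ≤ P 0)
    (hP' : ∀ t : ℝ, 0 ≤ t →
      -2 * L * (P t + Real.sqrt (P t * Q t)) ≤ deriv P t)
    (hQ' : ∀ t : ℝ, 0 ≤ t →
      deriv Q t ≤ -2 * a * Q t + 2 * L * (Real.sqrt (P t * Q t) + Q t)) :
    ∀ t : ℝ, 0 ≤ t → Q t ≤ P t := by
  intro t ht
  refine image_le_of_deriv_right_lt_deriv_boundary' (a := 0) (b := t)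
    (fun x hx => (hQdiff x hx.1).continuousAt.continuousWithinAt)
    (fun x hx => (hQdiff x hx.1).hasDerivAt.hasDerivWithinAt) h0
    (fun x hx => (hPdiff x hx.1).continuousAt.continuousWithinAt)
    (fun x hx => (hPdiff x hx.1).hasDerivAt.hasDerivWithinAt) ?_ ⟨ht, le_rfl⟩
  intro x hx hQP
  have hpos := hPpos x hx.1
  have hP := hP' x hx.1
  have hQ := hQ' x hx.1
  rw [hQP, Real.sqrt_mul_self hpos.le] at hP hQ
  linarith [mul_lt_mul_of_pos_right ha hpos]
end
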